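/- Let K be a chain in the poset E(P) and let ε ∈ {1,-1}^P satisfy ε(v) = sgn(K)(v) for every v ∈ supp(sgn(K)). Then T^e_K = R_ε(T_{supp(K)}). -/

import Mathlib

open Classical

/-- An order filter (upper set) of a poset. -/
def IsOrderFilter {P : Type*} [PartialOrder P] (F : Set P) : Prop :=
  ∀ ⦃u v : P⦄, u ∈ F → u ≤ v → v ∈ F

/-- The support of an integer-valued map. -/
def zsupp {P : Type*} (f : P → ℤ) : Set P := {v | f v ≠ 0}

/-- Membership in `E(P)`. -/
def IsEF {P : Type*} [PartialOrder P] (f : P → ℤ) : Prop :=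
  (∀ v, f v = 1 ∨ f v = 0 ∨ f v = -1) ∧
  IsOrderFilter (zsupp f) ∧
  ∀ v ∈ zsupp f, ¬ Minimal (· ∈ zsupp f) v → f v = 1

/-- The strict relation `f > g` on `E(P)`. -/
def egt {P : Type*} [PartialOrder P] (f g : P → ℤ) : Prop :=
  zsupp g ⊂ zsupp f ∧
  (∀ v ∈ zsupp g, g v ≤ f v) ∧
  ∀ v ∈ zsupp g, Minimal (· ∈ zsupp f) v → f v = g v

/-- The relation `f ≥ g` on `E(P)`. -/
def ege {P : Type*} [PartialOrder P] (f g : P → ℤ) : Prop := f = g ∨ egt f g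

/-- A chain in the poset `E(P)`. -/
def IsEChain {P : Type*} [PartialOrder P] (K : Set (P → ℤ)) : Prop :=
  (∀ f ∈ K, IsEF f) ∧ IsChain ege K

/-- A maximal chain in the poset `E(P)`. -/
def IsMaxEChain {P : Type*} [PartialOrder P] (K : Set (P → ℤ)) : Prop :=
  IsEChain K ∧ ∀ L, IsEChain L → K ⊆ L → K = L

/-- The set of minimal elements of a subset. -/
def minSet {P : Type*} [PartialOrder P] (F : Set P) : Set P := {v | Minimal (· ∈ F) v}

/-- The signature of a chain in `E(P)`. -/
noncomputable def esgn {P : Type*} [PartialOrder P] (K : Set (P → ℤ)) (v : P) : ℤ :=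
  if h : ∃ f ∈ K, Minimal (· ∈ zsupp f) v then h.choose v else 0

/-- The enriched transfer map. -/
noncomputable def ePhi {P : Type*} [PartialOrder P] (f : P → ℤ) : P → ℝ :=
  fun v => if Minimal (· ∈ zsupp f) v then (f v : ℝ) else 0

/-- The simplex `T^e_K` attached to a chain `K` in `E(P)`. -/
noncomputable def Tsimp {P : Type*} [PartialOrder P] (K : Set (P → ℤ)) : Set (P → ℝ) :=
  convexHull ℝ (ePhi '' K)

/-- Indicator of the set of minimal elements of `F`. -/
noncomputable def chiMin {P : Type*} [PartialOrder P] (F : Set P) : P → ℝ :=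
  fun v => if Minimal (· ∈ F) v then 1 else 0

/-- The simplex `T_C` attached to a chain `C` of order filters. -/
noncomputable def TCsimp {P : Type*} [PartialOrder P] (C : Set (Set P)) : Set (P → ℝ) :=
  convexHull ℝ (chiMin '' C)

/-- The sign-change map `R_φ`. -/
def Rmap {P : Type*} (φ : P → ℤ) (g : P → ℝ) : P → ℝ :=
  fun v => if φ v = -1 then -g v else g v

/-- The orthant-type region `V_φ`. -/
def Vset {P : Type*} (φ : P → ℤ) : Set (P → ℝ) :=
  {g | ∀ v, (φ v = 1 → 0 ≤ g v) ∧ (φ v = 0 → g v = 0) ∧ (φ v = -1 → g v ≤ 0)}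

/-- The set `eA(P)` of `±1`-indicator vectors of antichains, inside `ℝ^P`. -/
def eAset (P : Type*) [PartialOrder P] : Set (P → ℝ) :=
  {g | (∀ v, g v = 1 ∨ g v = 0 ∨ g v = -1) ∧ IsAntichain (· ≤ ·) {v | g v ≠ 0}}

/-- The enriched chain polytope `eC(P)`. -/
noncomputable def eChainPolytope (P : Type*) [PartialOrder P] : Set (P → ℝ) :=
  convexHull ℝ (eAset P)

/-- The chain polytope `C(P)`. -/
noncomputable def chainPolytope (P : Type*) [PartialOrder P] : Set (P → ℝ) :=
  convexHull ℝ {g : P → ℝ | ∃ A : Set P, IsAntichain (· ≤ ·) A ∧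
    g = fun v => if v ∈ A then 1 else 0}

/-- Members of a chain in `E(P)` agree at a common minimal element of their supports. -/
theorem IsEChain.apply_eq {P : Type*} [PartialOrder P] {K : Set (P → ℤ)} (hK : IsEChain K)
    {f g : P → ℤ} (hf : f ∈ K) (hg : g ∈ K) {v : P}
    (hfv : Minimal (· ∈ zsupp f) v) (hgv : Minimal (· ∈ zsupp g) v) : f v = g v := by
  rcases eq_or_ne f g with rfl | hne
  · rfl
  · rcases hK.2 hf hg hne with (h | h) | (h | h)
    · rw [h]
    · exact h.2.2 v hgv.prop hfv
    · rw [h]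
    · exact (h.2.2 v hfv.prop hgv).symm

theorem IsEChain.esgn_eq {P : Type*} [PartialOrder P] {K : Set (P → ℤ)} (hK : IsEChain K)
    {f : P → ℤ} (hf : f ∈ K) {v : P} (hfv : Minimal (· ∈ zsupp f) v) : esgn K v = f v := by
  have h : ∃ g ∈ K, Minimal (· ∈ zsupp g) v := ⟨f, hf, hfv⟩
  rw [esgn, dif_pos h]
  exact hK.apply_eq h.choose_spec.1 hf h.choose_spec.2 hfv

theorem isLinearMap_Rmap {P : Type*} (φ : P → ℤ) : IsLinearMap ℝ (Rmap φ) where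
  map_add x y := by
    ext v
    simp only [Rmap, Pi.add_apply]
    split_ifs <;> ring
  map_smul c x := by
    ext v
    simp only [Rmap, Pi.smul_apply, smul_eq_mul]
    split_ifs <;> ring

theorem Rmap_chiMin_zsupp {P : Type*} [PartialOrder P] {f ε : P → ℤ}
    (hε : ∀ v, ε v = 1 ∨ ε v = -1) (h : ∀ v, Minimal (· ∈ zsupp f) v → ε v = f v) :
    Rmap ε (chiMin (zsupp f)) = ePhi f := by
  ext v
  by_cases hv : Minimal (· ∈ zsupp f) v
  · rcases hε v with hv' | hv' <;> simp [Rmap, chiMin, ePhi, hv, ← h v hv, hv']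
  · simp [Rmap, chiMin, ePhi, hv]

theorem stmt16 {P : Type*} [Fintype P] [PartialOrder P] {K : Set (P → ℤ)}
    (hK : IsEChain K) (ε : P → ℤ) (hε : ∀ v, ε v = 1 ∨ ε v = -1)
    (hagree : ∀ v ∈ zsupp (esgn K), ε v = esgn K v) :
    Tsimp K = Rmap ε '' TCsimp (zsupp '' K) := by
  rw [Tsimp, TCsimp, (isLinearMap_Rmap ε).image_convexHull, Set.image_image, Set.image_image]
  refine congrArg _ (Set.image_congr fun f hf => (Rmap_chiMin_zsupp hε fun v hv => ?_).symm)
  have hs := hK.esgn_eq hf hv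
  rw [← hs]
  refine hagree v ?_
  change esgn K v ≠ 0
  rw [hs]
  exact hv.prop
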